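/- Let X be a Banach space and f : X → ℝ ∪ {+∞} a lower semicontinuous function satisfying condition (3.3). Assume there exist v₀, v₁ ∈ X and r > 0 such that ‖v₀‖ < r, ‖v₁‖ > r, inf{f(u) : u ∈ X, ‖u‖ ≤ r} > −∞, and inf{f(u) : u ∈ X, ‖u‖ = r} > max{f(v₀), f(v₁)}. Let Γ = {γ : [0,1] → dom(f) continuous with γ(0) = v₀, γ(1) = v₁}, assume Γ ≠ ∅, set c₁ = inf{f(u) : ‖u‖ ≤ r} and c₂ = inf_{γ∈Γ} sup_{t∈[0,1]} f(γ(t)), assume c₂ < +∞, and assume f satisfies the Palais–Smale condition at the levels c₁ and c₂. Then c₁ < c₂ and there exist at least two (lower) critical points u₁, u₂ of f with f(u₁) = c₁ and f(u₂) = c₂. -/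

import Mathlib

open Metric Set Filter
open scoped ENNReal

/-- The epigraph of `f : X → ℝ ∪ {+∞}`, as a subset of `X × ℝ`. -/
def epiSet {X : Type*} [MetricSpace X] (f : X → EReal) : Set (X × ℝ) :=
  {p | f p.1 ≤ (p.2 : EReal)}

/-- The metric on `X × ℝ`, `d((u,η),(v,μ)) = (d(u,v)² + (η−μ)²)^{1/2}`. -/
noncomputable def distE {X : Type*} [MetricSpace X] (p q : X × ℝ) : ℝ :=
  Real.sqrt (dist p.1 q.1 ^ 2 + (p.2 - q.2) ^ 2)

/-- The open ball in `X × ℝ` with respect to `distE`. -/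
def ballE {X : Type*} [MetricSpace X] (p : X × ℝ) (δ : ℝ) : Set (X × ℝ) :=
  {q | distE q p < δ}

/-- The set of admissible `σ` in the definition of the weak slope `|d G_f|(u, η)`. -/
def slopeSet {X : Type*} [MetricSpace X] (f : X → EReal) (u : X) (η : ℝ) : Set ℝ :=
  {σ | 0 ≤ σ ∧ ∃ δ : ℝ, 0 < δ ∧ ∃ H : X × ℝ → ℝ → X × ℝ,
    ContinuousOn (fun q : (X × ℝ) × ℝ => H q.1 q.2)
      ((ballE (u, η) δ ∩ epiSet f) ×ˢ Icc 0 δ) ∧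
    ∀ p ∈ ballE (u, η) δ ∩ epiSet f, ∀ t ∈ Icc (0:ℝ) δ,
      H p t ∈ epiSet f ∧ distE (H p t) p ≤ t ∧ (H p t).2 ≤ p.2 - σ * t}

/-- The weak slope `|d G_f|(u, η)` of `G_f` at `(u, η) ∈ epi f`. -/
noncomputable def slopeG {X : Type*} [MetricSpace X] (f : X → EReal) (u : X) (η : ℝ) : ℝ :=
  sSup (slopeSet f u η)

/-- The weak slope `|df|(u)` of a lower semicontinuous `f` at `u ∈ dom f`. -/
noncomputable def wslope {X : Type*} [MetricSpace X] (f : X → EReal) (u : X) : ℝ≥0∞ :=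
  if slopeG f u (f u).toReal < 1 then
    ENNReal.ofReal (slopeG f u (f u).toReal / Real.sqrt (1 - slopeG f u (f u).toReal ^ 2))
  else ⊤

/-- Admissible `σ` in the definition of the equivariant weak slope `|d_{ℤ₂} G_f|(0, η)`. -/
def slopeZ2Set {X : Type*} [NormedAddCommGroup X] [NormedSpace ℝ X]
    (f : X → EReal) (η : ℝ) : Set ℝ :=
  {σ | 0 ≤ σ ∧ ∃ δ : ℝ, 0 < δ ∧ ∃ H : X × ℝ → ℝ → X × ℝ,
    ContinuousOn (fun q : (X × ℝ) × ℝ => H q.1 q.2)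
      ((ballE ((0 : X), η) δ ∩ epiSet f) ×ˢ Icc 0 δ) ∧
    ∀ p ∈ ballE ((0 : X), η) δ ∩ epiSet f, ∀ t ∈ Icc (0:ℝ) δ,
      H p t ∈ epiSet f ∧ distE (H p t) p ≤ t ∧ (H p t).2 ≤ p.2 - σ * t ∧
      (H (-p.1, p.2) t).1 = -(H p t).1}

/-- The equivariant weak slope `|d_{ℤ₂} G_f|(0, η)`. -/
noncomputable def slopeZ2 {X : Type*} [NormedAddCommGroup X] [NormedSpace ℝ X]
    (f : X → EReal) (η : ℝ) : ℝ :=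
  sSup (slopeZ2Set f η)

/-- Condition (3.3). -/
def cond33 {X : Type*} [MetricSpace X] (f : X → EReal) : Prop :=
  ∀ (u : X) (η : ℝ), (u, η) ∈ epiSet f → f u < (η : EReal) → slopeG f u η = 1

/-- The Palais–Smale condition at level `c`. -/
def PScond {X : Type*} [MetricSpace X] (f : X → EReal) (c : ℝ) : Prop :=
  ∀ u : ℕ → X, (∀ n, f (u n) ≠ ⊤) →
    Tendsto (fun n => wslope f (u n)) atTop (nhds 0) →
    Tendsto (fun n => f (u n)) atTop (nhds (c : EReal)) →
    ∃ (v : X) (φ : ℕ → ℕ), StrictMono φ ∧ Tendsto (fun n => u (φ n)) atTop (nhds v)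

section Slope

variable {X : Type*} [MetricSpace X] {f : X → EReal}

theorem dist_le_distE (p q : X × ℝ) : dist p q ≤ distE p q := by
  rw [Prod.dist_eq, Real.dist_eq]
  refine max_le (Real.le_sqrt_of_sq_le ?_) (Real.le_sqrt_of_sq_le ?_)
  · nlinarith [sq_nonneg (p.2 - q.2)]
  · rw [sq_abs]
    nlinarith [sq_nonneg (dist p.1 q.1)]

theorem distE_le_two_mul_dist (p q : X × ℝ) : distE p q ≤ 2 * dist p q := by
  have h1 : dist p.1 q.1 ≤ dist p q := le_max_left _ _
  have h2 : |p.2 - q.2| ≤ dist p q := le_max_right _ _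
  have h3 : (p.2 - q.2) ^ 2 ≤ dist p q ^ 2 := sq_le_sq' (abs_le.1 h2).1 (abs_le.1 h2).2
  refine Real.sqrt_le_iff.2 ⟨by positivity, ?_⟩
  nlinarith [dist_nonneg (x := p.1) (y := q.1), dist_nonneg (x := p) (y := q)]

theorem mem_ballE_of_dist_lt {p q : X × ℝ} {δ : ℝ} (h : dist q p < δ / 2) : q ∈ ballE p δ :=
  (distE_le_two_mul_dist q p).trans_lt (by linarith)

theorem mem_ballE_self (p : X × ℝ) {δ : ℝ} (h : 0 < δ) : p ∈ ballE p δ :=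
  mem_ballE_of_dist_lt (by simpa using h)

theorem ballE_subset_ballE {p q : X × ℝ} {δ : ℝ} (h : dist q p < δ / 4) :
    ballE q (δ / 4) ⊆ ballE p δ := fun x hx => mem_ballE_of_dist_lt <| by
  have h1 : dist x q < δ / 4 := (dist_le_distE x q).trans_lt hx
  linarith [dist_triangle x q p]

theorem zero_mem_slopeSet (u : X) (η : ℝ) : (0 : ℝ) ∈ slopeSet f u η := by
  refine ⟨le_rfl, 1, one_pos, fun p _ => p, continuous_fst.continuousOn, fun p hp t ht => ?_⟩
  exact ⟨hp.2, by simpa [distE] using ht.1, by simp⟩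

theorem slopeSet_mono {u : X} {η σ σ' : ℝ} (hσ : σ ∈ slopeSet f u η) (h0 : 0 ≤ σ')
    (h : σ' ≤ σ) : σ' ∈ slopeSet f u η := by
  obtain ⟨-, δ, hδ, H, hH, hp⟩ := hσ
  refine ⟨h0, δ, hδ, H, hH, fun p hpm t ht => ?_⟩
  obtain ⟨h1, h2, h3⟩ := hp p hpm t ht
  exact ⟨h1, h2, by nlinarith [mul_le_mul_of_nonneg_right h ht.1]⟩

theorem le_one_of_mem_slopeSet {u : X} {η σ : ℝ} (hu : (u, η) ∈ epiSet f)
    (hσ : σ ∈ slopeSet f u η) : σ ≤ 1 := by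
  obtain ⟨-, δ, hδ, H, -, hp⟩ := hσ
  obtain ⟨-, h2, h3⟩ := hp (u, η) ⟨mem_ballE_self _ hδ, hu⟩ δ ⟨hδ.le, le_rfl⟩
  have h4 : |(H (u, η) δ).2 - η| ≤ δ :=
    (le_max_right _ _).trans ((dist_le_distE (H (u, η) δ) (u, η)).trans h2)
  have h5 := (abs_le.1 h4).1
  dsimp only at h3
  by_contra! h
  nlinarith

theorem bddAbove_slopeSet {u : X} {η : ℝ} (hu : (u, η) ∈ epiSet f) :
    BddAbove (slopeSet f u η) := ⟨1, fun _ => le_one_of_mem_slopeSet hu⟩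

theorem slopeG_nonneg {u : X} {η : ℝ} (hu : (u, η) ∈ epiSet f) : 0 ≤ slopeG f u η :=
  le_csSup (bddAbove_slopeSet hu) (zero_mem_slopeSet u η)

theorem mem_slopeSet_of_lt_slopeG {u : X} {η σ : ℝ} (h0 : 0 ≤ σ) (h : σ < slopeG f u η) :
    σ ∈ slopeSet f u η := by
  obtain ⟨τ, hτ, hlt⟩ := exists_lt_of_lt_csSup ⟨0, zero_mem_slopeSet u η⟩ h
  exact slopeSet_mono hτ h0 hlt.le

theorem eventually_mem_slopeSet {p : X × ℝ} {σ : ℝ} (hσ : σ ∈ slopeSet f p.1 p.2) :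
    ∀ᶠ q in nhds p, σ ∈ slopeSet f q.1 q.2 := by
  obtain ⟨h0, δ, hδ, H, hH, hp⟩ := hσ
  filter_upwards [Metric.ball_mem_nhds p (show 0 < δ / 4 by linarith)] with q hq
  have hsub : ballE q (δ / 4) ∩ epiSet f ⊆ ballE p δ ∩ epiSet f :=
    inter_subset_inter_left _ (ballE_subset_ballE hq)
  have hI : Icc (0 : ℝ) (δ / 4) ⊆ Icc 0 δ := Icc_subset_Icc_right (by linarith)
  exact ⟨h0, δ / 4, by linarith, H, hH.mono (prod_mono hsub hI),
    fun x hx t ht => hp x (hsub hx) t (hI ht)⟩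

/-- The weak slope of `G_f` is lower semicontinuous along sequences. -/
theorem slopeG_le_of_tendsto {p : X × ℝ} {q : ℕ → X × ℝ} {s : ℕ → ℝ} {a : ℝ}
    (hq : Tendsto q atTop (nhds p)) (hmem : ∀ n, q n ∈ epiSet f) (hs : Tendsto s atTop (nhds a))
    (hle : ∀ n, slopeG f (q n).1 (q n).2 ≤ s n) : slopeG f p.1 p.2 ≤ a := by
  refine csSup_le ⟨0, zero_mem_slopeSet _ _⟩ fun σ hσ => ge_of_tendsto hs ?_
  filter_upwards [hq.eventually (eventually_mem_slopeSet hσ)] with n hn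
  exact (le_csSup (bddAbove_slopeSet (hmem n)) hn).trans (hle n)

theorem isClosed_epiSet (hlsc : LowerSemicontinuous f) : IsClosed (epiSet f) :=
  hlsc.isClosed_epigraph.preimage
    (continuous_fst.prodMk (continuous_coe_real_ereal.comp continuous_snd))

theorem eq_coe_of_slopeG_lt_one (h33 : cond33 f) {u : X} {η : ℝ} (hu : (u, η) ∈ epiSet f)
    (h : slopeG f u η < 1) : f u = η :=
  (le_iff_eq_or_lt.1 (show f u ≤ (η : EReal) from hu)).resolve_right
    fun hlt => h.ne (h33 u η hu hlt)

/-- Points of the epigraph at almost the level `c` and with almost vanishing slope produce, under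
the Palais–Smale condition, a critical point at the level `c`. -/
theorem exists_critical_of_slopeG_le (hlsc : LowerSemicontinuous f) (h33 : cond33 f) {c : ℝ}
    (hPS : PScond f c)
    (happ : ∀ ε : ℝ, 0 < ε → ∃ p ∈ epiSet f, |p.2 - c| ≤ ε ∧ slopeG f p.1 p.2 ≤ ε) :
    ∃ v : X, f v ≠ ⊤ ∧ wslope f v = 0 ∧ f v = (c : EReal) := by
  have hε : Tendsto (fun n : ℕ => (1 / 2 : ℝ) ^ (n + 1)) atTop (nhds 0) :=
    (tendsto_pow_atTop_nhds_zero_of_lt_one (by norm_num) (by norm_num)).comp (tendsto_add_atTop_nat 1)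
  choose p hp hc hs using fun n : ℕ => happ ((1 / 2 : ℝ) ^ (n + 1)) (by positivity)
  have hs1 : ∀ n, slopeG f (p n).1 (p n).2 < 1 := fun n =>
    (hs n).trans_lt (pow_lt_one₀ (by norm_num) (by norm_num) (Nat.succ_ne_zero n))
  have hf : ∀ n, f (p n).1 = ((p n).2 : EReal) := fun n =>
    eq_coe_of_slopeG_lt_one h33 (hp n) (hs1 n)
  have hη : Tendsto (fun n => (p n).2) atTop (nhds c) := by
    refine tendsto_iff_dist_tendsto_zero.2
      (squeeze_zero (fun _ => dist_nonneg) (fun n => ?_) hε)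
    rw [Real.dist_eq]
    exact hc n
  have hs0 : Tendsto (fun n => slopeG f (p n).1 (p n).2) atTop (nhds 0) :=
    squeeze_zero (fun n => slopeG_nonneg (hp n)) hs hε
  have hw : Tendsto (fun n => wslope f (p n).1) atTop (nhds 0) := by
    have hcont : ContinuousAt (fun s : ℝ => ENNReal.ofReal (s / Real.sqrt (1 - s ^ 2))) 0 := by
      refine ENNReal.continuous_ofReal.continuousAt.comp ?_
      exact continuousAt_id.div (by fun_prop) (by simp)
    have := hcont.tendsto.comp hs0
    simp only [zero_div, ENNReal.ofReal_zero] at this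
    refine this.congr fun n => ?_
    have h1 := hs1 n
    simp only [wslope, hf n, EReal.toReal_coe, h1, if_true, Function.comp]
  obtain ⟨v, φ, hφ, hv⟩ := hPS (fun n => (p n).1) (fun n => by simp [hf n]) hw
    (by simpa only [hf, Function.comp_def] using (continuous_coe_real_ereal.tendsto c).comp hη)
  have hq : Tendsto (fun n => p (φ n)) atTop (nhds (v, c)) :=
    hv.prodMk_nhds (hη.comp hφ.tendsto_atTop)
  have hmem : (v, c) ∈ epiSet f :=
    (isClosed_epiSet hlsc).mem_of_tendsto hq (Eventually.of_forall fun n => hp (φ n))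
  have hslope : slopeG f v c = 0 :=
    (slopeG_le_of_tendsto hq (fun n => hp (φ n)) (hε.comp hφ.tendsto_atTop)
      fun n => hs (φ n)).antisymm (slopeG_nonneg hmem)
  have hfv : f v = c := eq_coe_of_slopeG_lt_one h33 hmem (by rw [hslope]; exact one_pos)
  exact ⟨v, by simp [hfv], by simp [wslope, hfv, hslope], hfv⟩

end Slope

/-- The weak form of Ekeland's variational principle. -/
theorem exists_forall_sub_mul_dist_le {P : Type*} [MetricSpace P] [CompleteSpace P] {g : P → ℝ}
    (hg : Continuous g) {m : ℝ} (hm : ∀ x, m ≤ g x) (x₀ : P) {ε : ℝ} (hε : 0 < ε) :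
    ∃ x, g x ≤ g x₀ ∧ ∀ y, g x - ε * dist x y ≤ g y := by
  let S : P → Set P := fun x => {y | g y + ε * dist x y ≤ g x}
  have hself : ∀ x, x ∈ S x := fun x => by simp [S]
  have htrans : ∀ {x y z}, y ∈ S x → z ∈ S y → z ∈ S x := fun {x y z} hy hz => by
    simp only [S, mem_ofPred_eq] at *
    nlinarith [dist_triangle x y z]
  have hclosed : ∀ x, IsClosed (S x) := fun x => isClosed_le (by fun_prop) continuous_const
  have hbdd : ∀ x, BddBelow (g '' S x) := fun x => ⟨m, by rintro _ ⟨y, -, rfl⟩; exact hm y⟩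
  have hstep : ∀ (n : ℕ) (x : P), ∃ y ∈ S x, ∀ z ∈ S x, g y ≤ g z + (1 / 2) ^ n := fun n x => by
    obtain ⟨_, ⟨y, hy, rfl⟩, hlt⟩ := exists_lt_of_csInf_lt (s := g '' S x)
      ⟨_, mem_image_of_mem g (hself x)⟩
      (lt_add_of_pos_right (sInf (g '' S x)) (show (0 : ℝ) < (1 / 2) ^ n by positivity))
    refine ⟨y, hy, fun z hz => hlt.le.trans ?_⟩
    gcongr
    exact csInf_le (hbdd x) (mem_image_of_mem g hz)
  choose T hT hTle using hstep
  let x : ℕ → P := fun n => Nat.rec x₀ T n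
  have hx : ∀ n, x (n + 1) ∈ S (x n) := fun n => hT n (x n)
  have hmono : ∀ n k, x (n + k) ∈ S (x n) := fun n k => by
    induction k with
    | zero => exact hself _
    | succ k ih => exact htrans ih (hx (n + k))
  have hsmall : ∀ n, ∀ y ∈ S (x (n + 1)), dist y (x (n + 1)) ≤ (1 / 2) ^ n / ε := fun n y hy => by
    have h1 : g (x (n + 1)) ≤ g y + (1 / 2) ^ n := hTle n (x n) y (htrans (hx n) hy)
    have h2 : g y + ε * dist (x (n + 1)) y ≤ g (x (n + 1)) := hy
    rw [le_div_iff₀ hε, dist_comm]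
    linarith
  have hlim : Tendsto (fun n : ℕ => (1 / 2 : ℝ) ^ n / ε) atTop (nhds 0) := by
    simpa using (tendsto_pow_atTop_nhds_zero_of_lt_one (r := (1 / 2 : ℝ))
      (by norm_num) (by norm_num)).div_const ε
  have hcauchy : CauchySeq fun n => x (n + 1) := by
    refine cauchySeq_of_le_tendsto_0' _ (fun n k hnk => ?_) hlim
    obtain ⟨j, rfl⟩ := Nat.exists_eq_add_of_le hnk
    rw [dist_comm]
    refine hsmall n _ ?_
    rw [show n + j + 1 = n + 1 + j by ring]
    exact hmono _ _
  obtain ⟨z, hz⟩ := cauchySeq_tendsto_of_complete hcauchy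
  have hzS : ∀ n, z ∈ S (x n) := fun n => by
    refine (hclosed (x n)).mem_of_tendsto hz ?_
    filter_upwards [eventually_ge_atTop n] with k hk
    obtain ⟨j, rfl⟩ := Nat.exists_eq_add_of_le hk
    exact hmono n (j + 1)
  refine ⟨z, ?_, fun y => ?_⟩
  · have h : g z + ε * dist x₀ z ≤ g x₀ := hzS 0
    nlinarith [dist_nonneg (x := x₀) (y := z)]
  · by_contra! hlt
    have hy : y ∈ S z := by
      simp only [S, mem_ofPred_eq]
      linarith
    have hxy : Tendsto (fun n => x (n + 1)) atTop (nhds y) := by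
      refine tendsto_iff_dist_tendsto_zero.2 (squeeze_zero (fun _ => dist_nonneg) (fun n => ?_) hlim)
      rw [dist_comm]
      exact hsmall n y (htrans (hzS (n + 1)) hy)
    obtain rfl := tendsto_nhds_unique hz hxy
    simp at hlt

section Deformation

variable {X : Type*} [MetricSpace X] {f : X → EReal} {Y : Type*} [TopologicalSpace Y]

/-- Moving `γ` along a single local deformation `H`, for the times `t * l s` with `l` supported
where `γ` is near the centre of `H`. -/
theorem exists_local_deformation {γ γ' : C(Y, X × ℝ)} (hγ' : ∀ s, γ' s ∈ epiSet f) {σ t δ : ℝ}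
    {p : X × ℝ} {H : X × ℝ → ℝ → X × ℝ}
    (hH : ContinuousOn (fun q : (X × ℝ) × ℝ => H q.1 q.2)
      ((ballE p δ ∩ epiSet f) ×ˢ Icc 0 δ))
    (hHp : ∀ q ∈ ballE p δ ∩ epiSet f, ∀ t ∈ Icc (0 : ℝ) δ,
      H q t ∈ epiSet f ∧ distE (H q t) q ≤ t ∧ (H q t).2 ≤ q.2 - σ * t)
    (ht0 : 0 ≤ t) (ht : t < δ / 4) (hdist : ∀ s, dist (γ' s) (γ s) ≤ t) {l : C(Y, ℝ)}
    (hl0 : ∀ s, 0 ≤ l s) (hl1 : ∀ s, l s ≤ 1)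
    (hsupp : tsupport l ⊆ {s | dist (γ s) p < δ / 4}) :
    ∃ γ'' : C(Y, X × ℝ), (∀ s, γ'' s ∈ epiSet f) ∧ (∀ s, dist (γ'' s) (γ' s) ≤ t * l s) ∧
      ∀ s, (γ'' s).2 ≤ (γ' s).2 - σ * (t * l s) := by
  classical
  let U : Set Y := {s | dist (γ s) p < δ / 4}
  have hUo : IsOpen U := isOpen_lt (by fun_prop) continuous_const
  have hball : ∀ s ∈ U, γ' s ∈ ballE p δ ∩ epiSet f := fun s hs =>
    ⟨mem_ballE_of_dist_lt (by
      have h1 := dist_triangle (γ' s) (γ s) p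
      have h2 := hdist s
      have h3 : dist (γ s) p < δ / 4 := hs
      linarith), hγ' s⟩
  have hI : ∀ s, t * l s ∈ Icc (0 : ℝ) δ := fun s =>
    ⟨mul_nonneg ht0 (hl0 s), by nlinarith [hl1 s, hl0 s]⟩
  have hzero : ∀ s ∉ tsupport l, l s = 0 := fun s hs => image_eq_zero_of_notMem_tsupport hs
  let h : Y → X × ℝ := fun s => if s ∈ U then H (γ' s) (t * l s) else γ' s
  have hU : ∀ s ∈ U, h s = H (γ' s) (t * l s) := fun s hs => if_pos hs
  have hoff : ∀ s, l s = 0 → h s = γ' s := fun s hs => by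
    by_cases hsU : s ∈ U
    · have h1 := (hHp _ (hball s hsU) _ (hI s)).2.1
      rw [hU s hsU]
      refine dist_le_zero.1 ((dist_le_distE _ _).trans (h1.trans ?_))
      simp [hs]
    · exact if_neg hsU
  have hcont : Continuous h := by
    refine continuous_iff_continuousAt.2 fun s => ?_
    by_cases hs : s ∈ tsupport l
    · have hc : ContinuousOn (fun s => H (γ' s) (t * l s)) U :=
        hH.comp (f := fun s => (γ' s, t * l s)) (by fun_prop) fun s hs => ⟨hball s hs, hI s⟩
      exact (hc.congr hU).continuousAt (hUo.mem_nhds (hsupp hs))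
    · refine γ'.continuous.continuousAt.congr ?_
      filter_upwards [(isClosed_tsupport l).isOpen_compl.mem_nhds hs] with x hx
      exact (hoff x (hzero x hx)).symm
  refine ⟨⟨h, hcont⟩, fun s => ?_, fun s => ?_, fun s => ?_⟩ <;>
    simp only [ContinuousMap.coe_mk] <;> by_cases hs : s ∈ U
  · exact hU s hs ▸ (hHp _ (hball s hs) _ (hI s)).1
  · exact (show h s = γ' s from if_neg hs) ▸ hγ' s
  · exact hU s hs ▸ (dist_le_distE _ _).trans (hHp _ (hball s hs) _ (hI s)).2.1
  · rw [hoff s (hzero s fun hs' => hs (hsupp hs')), dist_self]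
    exact (hI s).1
  · exact hU s hs ▸ (hHp _ (hball s hs) _ (hI s)).2.2
  · have h0 := hzero s fun hs' => hs (hsupp hs')
    simp [hoff s h0, h0]

/-- If the slope of `G_f` exceeds `σ` along `γ` on a closed set `K`, then `γ` can be pushed down at
rate `σ` on `K` without being moved outside a neighbourhood `V` of `K`. -/
theorem exists_deformation [CompactSpace Y] [NormalSpace Y] {γ : C(Y, X × ℝ)}
    (hγ : ∀ s, γ s ∈ epiSet f) {σ : ℝ} {K V : Set Y} (hK : IsClosed K) (hV : IsOpen V)
    (hKV : K ⊆ V) (hσ0 : 0 ≤ σ) (hσ : ∀ s ∈ K, σ ∈ slopeSet f (γ s).1 (γ s).2) :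
    ∃ t, 0 < t ∧ t ≤ 1 ∧ ∃ γ' : C(Y, X × ℝ), (∀ s, γ' s ∈ epiSet f) ∧
      (∀ s, dist (γ' s) (γ s) ≤ t) ∧ (∀ s, (γ' s).2 ≤ (γ s).2) ∧
      (∀ s ∈ K, (γ' s).2 ≤ (γ s).2 - σ * t) ∧ ∀ s ∉ V, γ' s = γ s := by
  choose! δ hδ H hH hHp using fun s hs => (hσ s hs).2
  let W : Y → Set Y := fun s => {x | dist (γ x) (γ s) < δ s / 4} ∩ V
  have hWo : ∀ s, IsOpen (W s) := fun s => (isOpen_lt (by fun_prop) continuous_const).inter hV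
  obtain ⟨F, hFK, hF⟩ := hK.isCompact.elim_nhds_subcover W fun s hs =>
    (hWo s).mem_nhds ⟨by simpa using hδ s hs, hKV hs⟩
  obtain ⟨ρ, hρ⟩ := PartitionOfUnity.exists_isSubordinate hK (fun i : F => W i)
    (fun i => hWo i) (fun s hs => by simpa using hF hs)
  obtain ⟨t, ht0, ht1, htδ⟩ : ∃ t : ℝ, 0 < t ∧ t ≤ 1 ∧ ∀ i : F, t < δ i / 4 := by
    have h1 : ∀ᶠ t in nhdsWithin (0 : ℝ) (Ioi 0), ∀ i : F, t < δ i / 4 :=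
      eventually_all.2 fun i => nhdsWithin_le_nhds
        (Iio_mem_nhds (by have := hδ i (hFK i i.2); linarith))
    have h2 : ∀ᶠ t in nhdsWithin (0 : ℝ) (Ioi 0), t ≤ 1 :=
      nhdsWithin_le_nhds (Iic_mem_nhds one_pos)
    obtain ⟨t, ⟨h3, h4⟩, h5⟩ := ((h1.and h2).and self_mem_nhdsWithin).exists
    exact ⟨t, h5, h4, h3⟩
  have hfin : ∀ s, ∑ᶠ i, ρ i s = ∑ i, ρ i s := fun s => finsum_eq_sum_of_fintype _
  have hsum : ∀ (A : Finset F) (s : Y), ∑ i ∈ A, ρ i s ≤ 1 := fun A s =>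
    (Finset.sum_le_sum_of_subset_of_nonneg (Finset.subset_univ A)
      fun i _ _ => ρ.nonneg i s).trans (hfin s ▸ ρ.sum_le_one s)
  have key : ∀ A : Finset F, ∃ γ' : C(Y, X × ℝ), (∀ s, γ' s ∈ epiSet f) ∧
      (∀ s, dist (γ' s) (γ s) ≤ t * ∑ i ∈ A, ρ i s) ∧
      ∀ s, (γ' s).2 ≤ (γ s).2 - σ * (t * ∑ i ∈ A, ρ i s) := fun A => by
    classical
    induction A using Finset.induction_on with
    | empty => exact ⟨γ, hγ, by simp, by simp⟩
    | insert i A hi ih =>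
      obtain ⟨γ', h1, h2, h3⟩ := ih
      obtain ⟨γ'', h4, h5, h6⟩ := exists_local_deformation (γ := γ) h1 (hH i (hFK i i.2))
        (hHp i (hFK i i.2)) ht0.le (htδ i)
        (fun s => (h2 s).trans (by nlinarith [hsum A s])) (l := ρ i) (ρ.nonneg i) (ρ.le_one i)
        ((hρ i).trans inter_subset_left)
      refine ⟨γ'', h4, fun s => ?_, fun s => ?_⟩ <;> rw [Finset.sum_insert hi]
      · linarith [dist_triangle (γ'' s) (γ' s) (γ s), h5 s, h2 s]
      · linarith [h6 s, h3 s]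
  obtain ⟨γ', h1, h2, h3⟩ := key Finset.univ
  refine ⟨t, ht0, ht1, γ', h1, fun s => (h2 s).trans (by nlinarith [hsum Finset.univ s]),
    fun s => (h3 s).trans ?_, fun s hs => ?_, fun s hs => ?_⟩
  · have h4 : 0 ≤ ∑ i, ρ i s := Finset.sum_nonneg fun i _ => ρ.nonneg i s
    have : 0 ≤ σ * (t * ∑ i, ρ i s) := by positivity
    linarith
  · have h4 := h3 s
    rwa [← hfin, ρ.sum_eq_one hs, mul_one] at h4
  · have h4 : ∑ i, ρ i s = 0 := Finset.sum_eq_zero fun i _ =>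
      image_eq_zero_of_notMem_tsupport fun hs' => hs (hρ i hs').2
    have h5 := h2 s
    rw [h4, mul_zero] at h5
    exact dist_le_zero.1 h5

end Deformation

section MountainPass

/-- The maximal height reached by a path in `X × ℝ`. -/
noncomputable def maxHeight {X : Type*} [MetricSpace X] (γ : C(unitInterval, X × ℝ)) : ℝ :=
  ⨆ s, (γ s).2

variable {X : Type*} [MetricSpace X] {f : X → EReal}

theorem le_maxHeight (γ : C(unitInterval, X × ℝ)) (s : unitInterval) :
    (γ s).2 ≤ maxHeight γ :=
  le_ciSup (f := fun s => (γ s).2)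
    (isCompact_range (continuous_snd.comp γ.continuous)).bddAbove s

theorem maxHeight_le {γ : C(unitInterval, X × ℝ)} {b : ℝ} (h : ∀ s, (γ s).2 ≤ b) :
    maxHeight γ ≤ b := ciSup_le h

theorem continuous_maxHeight :
    Continuous (maxHeight : C(unitInterval, X × ℝ) → ℝ) := by
  refine (LipschitzWith.of_le_add fun γ γ' => maxHeight_le fun s => ?_).continuous
  have h1 : |(γ s).2 - (γ' s).2| ≤ dist γ γ' :=
    (le_max_right (dist (γ s).1 (γ' s).1) _).trans
      (ContinuousMap.dist_apply_le_dist (f := γ) (g := γ') s)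
  linarith [(abs_le.1 h1).2, le_maxHeight γ' s]

/-- The mountain pass principle on the epigraph: there are points at almost the minimax level `c`
with almost vanishing slope. -/
theorem exists_slopeG_le_of_mountainPass [CompleteSpace X] (hlsc : LowerSemicontinuous f)
    {p₀ p₁ : X × ℝ} {c : ℝ} (hp₀ : p₀.2 < c) (hp₁ : p₁.2 < c)
    (hlow : ∀ γ : C(unitInterval, X × ℝ), (∀ s, γ s ∈ epiSet f) → γ 0 = p₀ → γ 1 = p₁ →
      c ≤ maxHeight γ)
    (hup : ∀ ε : ℝ, 0 < ε → ∃ γ : C(unitInterval, X × ℝ), (∀ s, γ s ∈ epiSet f) ∧ γ 0 = p₀ ∧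
      γ 1 = p₁ ∧ maxHeight γ ≤ c + ε) {ε : ℝ} (hε : 0 < ε) :
    ∃ p ∈ epiSet f, |p.2 - c| ≤ ε ∧ slopeG f p.1 p.2 ≤ ε := by
  wlog hsmall : p₀.2 < c - ε ∧ p₁.2 < c - ε generalizing ε
  · obtain ⟨b, hb, hbc⟩ := exists_between (max_lt hp₀ hp₁)
    have hlt := max_lt_iff.1 hb
    obtain ⟨p, hp, h1, h2⟩ := this (ε := min ε (c - b)) (lt_min hε (by linarith))
      ⟨by linarith [min_le_right ε (c - b)], by linarith [min_le_right ε (c - b)]⟩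
    exact ⟨p, hp, h1.trans (min_le_left _ _), h2.trans (min_le_left _ _)⟩
  by_contra! hcon
  obtain ⟨b, hb, hbc⟩ := exists_between (max_lt hsmall.1 hsmall.2)
  obtain ⟨hb₀, hb₁⟩ := max_lt_iff.1 hb
  let P : Set C(unitInterval, X × ℝ) := {γ | (∀ s, γ s ∈ epiSet f) ∧ γ 0 = p₀ ∧ γ 1 = p₁}
  have hP : IsClosed P := by
    refine IsClosed.inter ?_ (IsClosed.inter ?_ ?_)
    · have hInter : {γ : C(unitInterval, X × ℝ) | ∀ s, γ s ∈ epiSet f} =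
          ⋂ s, {γ | γ s ∈ epiSet f} := by
        ext
        simp
      change IsClosed {γ : C(unitInterval, X × ℝ) | ∀ s, γ s ∈ epiSet f}
      rw [hInter]
      exact isClosed_iInter fun s => (isClosed_epiSet hlsc).preimage (by fun_prop)
    · exact isClosed_eq (by fun_prop) continuous_const
    · exact isClosed_eq (by fun_prop) continuous_const
  have := hP.completeSpace_coe
  obtain ⟨γ₀, h1, h2, h3, hγ₀⟩ := hup ε hε
  obtain ⟨⟨γ, hγ, hγ0, hγ1⟩, hle, hmin⟩ := exists_forall_sub_mul_dist_le (P := P)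
    (g := fun γ => maxHeight γ.1) (continuous_maxHeight.comp continuous_subtype_val) (m := c)
    (fun γ => hlow γ.1 γ.2.1 γ.2.2.1 γ.2.2.2) ⟨γ₀, h1, h2, h3⟩ (half_pos hε)
  have hc : c ≤ maxHeight γ := hlow γ hγ hγ0 hγ1
  have hle' : maxHeight γ ≤ c + ε := hle.trans hγ₀
  obtain ⟨t, ht0, ht1, γ', hγ', hd, hdec, hdecK, hfix⟩ := exists_deformation hγ
    (σ := ε) (K := {s | c - ε ≤ (γ s).2}) (V := {s | b < (γ s).2})
    (isClosed_le continuous_const (by fun_prop)) (isOpen_lt continuous_const (by fun_prop))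
    (fun s hs => hbc.trans_le hs) hε.le fun s hs => by
      refine mem_slopeSet_of_lt_slopeG hε.le (hcon _ (hγ s) (abs_le.2 ⟨?_, ?_⟩))
      · linarith [show c - ε ≤ (γ s).2 from hs]
      · linarith [le_maxHeight γ s]
  have hstart : γ' 0 = p₀ := by
    rw [hfix 0 (by simpa [hγ0] using hb₀.le), hγ0]
  have hend : γ' 1 = p₁ := by
    rw [hfix 1 (by simpa [hγ1] using hb₁.le), hγ1]
  have hdrop : maxHeight γ' ≤ maxHeight γ - ε * t := maxHeight_le fun s => by
    by_cases hs : c - ε ≤ (γ s).2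
    · linarith [hdecK s hs, le_maxHeight γ s]
    · nlinarith [hdec s]
  have hd' : dist γ γ' ≤ t := by
    rw [dist_comm]
    exact (ContinuousMap.dist_le ht0.le).2 hd
  have hmin' : maxHeight γ - ε / 2 * dist γ γ' ≤ maxHeight γ' := hmin ⟨γ', hγ', hstart, hend⟩
  nlinarith [mul_pos hε ht0]

/-- A path `γ` below the height `b` lifts to a path in the epigraph below the height `b`, with
prescribed end points. -/
theorem exists_lift_epiSet {γ : ℝ → X} (hγ : ContinuousOn γ (Icc 0 1)) {a₀ a₁ b : ℝ}
    (h₀ : f (γ 0) = a₀) (h₁ : f (γ 1) = a₁) (hb : ∀ t ∈ Icc (0 : ℝ) 1, f (γ t) ≤ b) :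
    ∃ γ' : C(unitInterval, X × ℝ), (∀ s, γ' s ∈ epiSet f) ∧ γ' 0 = (γ 0, a₀) ∧
      γ' 1 = (γ 1, a₁) ∧ maxHeight γ' ≤ b := by
  have hb₀ : a₀ ≤ b := EReal.coe_le_coe_iff.1 (h₀ ▸ hb 0 (by simp))
  have hb₁ : a₁ ≤ b := EReal.coe_le_coe_iff.1 (h₁ ▸ hb 1 (by simp))
  let θ : ℝ → ℝ := fun s => max 0 (min 1 (3 * s - 1))
  have hθ : ∀ s, θ s ∈ Icc (0 : ℝ) 1 := fun s =>
    ⟨le_max_left _ _, max_le zero_le_one (min_le_left _ _)⟩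
  let h : ℝ → ℝ := fun s => min b (min (a₀ + 3 * s * (b - a₀)) (a₁ + 3 * (1 - s) * (b - a₁)))
  have hc : Continuous fun s : unitInterval => (γ (θ s), h s) := by
    refine Continuous.prodMk (hγ.comp_continuous (by fun_prop) fun s => hθ s) (by fun_prop)
  refine ⟨⟨_, hc⟩, fun s => ?_, ?_, ?_, maxHeight_le fun s => min_le_left _ _⟩
  · obtain ⟨s, hs0, hs1⟩ := s
    simp only [epiSet, mem_ofPred_eq, ContinuousMap.coe_mk]
    rcases le_total (3 * s) 1 with hs | hs
    · have hθs : θ s = 0 := by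
        simp only [θ]
        rw [min_eq_right (by linarith), max_eq_left (by linarith)]
      rw [hθs, h₀, EReal.coe_le_coe_iff]
      exact le_min hb₀ (le_min (by nlinarith) (by nlinarith))
    · rcases le_total (3 * s) 2 with hs' | hs'
      · have hh : h s = b := min_eq_left (le_min (by nlinarith) (by nlinarith))
        rw [hh]
        exact hb _ (hθ s)
      · have hθs : θ s = 1 := by
          simp only [θ]
          rw [min_eq_left (by linarith), max_eq_right (by linarith)]
        rw [hθs, h₁, EReal.coe_le_coe_iff]
        exact le_min hb₁ (le_min (by nlinarith) (by nlinarith))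
  · have h1 : a₀ ≤ a₁ + 3 * (b - a₁) := by linarith
    simp [θ, h, hb₀, h1]
  · have h1 : a₁ ≤ a₀ + 3 * (b - a₀) := by linarith
    have h2 : (1 : ℝ) ≤ 3 - 1 := by norm_num
    simp [θ, h, hb₁, h1, h2]

end MountainPass

/-- Almost minimizing points with almost vanishing slope, for a minimization problem on a closed
set whose minimizing points are interior. -/
theorem exists_slopeG_le_of_minimum {X : Type*} [MetricSpace X] [CompleteSpace X] {f : X → EReal}
    (hlsc : LowerSemicontinuous f) {D : Set X} (hD : IsClosed D) {c m : ℝ} (hcm : c < m)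
    (hint : ∀ u ∈ D, f u < m → D ∈ nhds u) (hlow : ∀ u ∈ D, (c : EReal) ≤ f u)
    (hup : ∀ b : ℝ, c < b → ∃ u ∈ D, f u < b) {ε : ℝ} (hε : 0 < ε) :
    ∃ p ∈ epiSet f, |p.2 - c| ≤ ε ∧ slopeG f p.1 p.2 ≤ ε := by
  obtain ⟨b, hcb, hb⟩ := exists_between (lt_min hcm (lt_add_of_pos_right c hε))
  obtain ⟨hbm, hbε⟩ := lt_min_iff.1 hb
  let P : Set (X × ℝ) := {p | p ∈ epiSet f ∧ p.1 ∈ D}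
  have hP : IsClosed P := (isClosed_epiSet hlsc).inter (hD.preimage continuous_fst)
  have := hP.completeSpace_coe
  have hPc : ∀ p ∈ P, c ≤ p.2 := fun p hp => EReal.coe_le_coe_iff.1 ((hlow _ hp.2).trans hp.1)
  obtain ⟨u₀, hu₀, hfu₀⟩ := hup b hcb
  obtain ⟨⟨p, hp, hpD⟩, hle, hmin⟩ := exists_forall_sub_mul_dist_le (P := P) (g := fun p => p.1.2)
    (by fun_prop) (m := c) (fun p => hPc p.1 p.2) ⟨(u₀, b), hfu₀.le, hu₀⟩ hε
  have hle' : p.2 ≤ b := hle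
  have hpc : c ≤ p.2 := hPc p ⟨hp, hpD⟩
  refine ⟨p, hp, abs_le.2 ⟨by linarith, by linarith⟩,
    csSup_le ⟨0, zero_mem_slopeSet _ _⟩ fun σ hσ => ?_⟩
  obtain ⟨-, δ, hδ, H, -, hH⟩ := hσ
  have hnhds : D ∈ nhds p.1 := hint _ hpD
    ((show f p.1 ≤ (p.2 : EReal) from hp).trans_lt (EReal.coe_lt_coe_iff.2 (by linarith)))
  obtain ⟨ρ, hρ, hball⟩ := Metric.mem_nhds_iff.1 hnhds
  obtain ⟨t, ht0, ht⟩ := exists_between (lt_min hδ hρ)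
  obtain ⟨htδ, htρ⟩ := lt_min_iff.1 ht
  obtain ⟨h1, h2, h3⟩ := hH p ⟨mem_ballE_self _ hδ, hp⟩ t ⟨ht0.le, htδ.le⟩
  have hd : dist (H p t) p ≤ t := (dist_le_distE _ _).trans h2
  have hmem : (H p t).1 ∈ D := hball (((le_max_left _ _).trans hd).trans_lt htρ)
  have h4 : p.2 - ε * dist p (H p t) ≤ (H p t).2 := hmin ⟨H p t, h1, hmem⟩
  rw [dist_comm] at h4
  by_contra! hlt
  nlinarith

/-- **Theorem 3.9 (second part).** Two critical points for a lower semicontinuous function on a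
Banach space with the given geometry, at levels `c₁ = inf f(closed ball)` and
`c₂ = inf_Γ sup f ∘ γ`, with `c₁ < c₂`. -/
theorem statement7 {X : Type*} [NormedAddCommGroup X] [NormedSpace ℝ X] [CompleteSpace X]
    (f : X → EReal) (hlsc : LowerSemicontinuous f) (hbot : ∀ x, f x ≠ ⊥)
    (h33 : cond33 f)
    (v₀ v₁ : X) (r : ℝ) (hr : 0 < r) (h0 : ‖v₀‖ < r) (h1 : r < ‖v₁‖)
    (hbdd : ⊥ < ⨅ u ∈ {u : X | ‖u‖ ≤ r}, f u)
    (hgeom : max (f v₀) (f v₁) < ⨅ u ∈ {u : X | ‖u‖ = r}, f u)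
    (Γ : Set (ℝ → X))
    (hΓ : Γ = {γ | ContinuousOn γ (Icc 0 1) ∧ γ 0 = v₀ ∧ γ 1 = v₁ ∧
      ∀ t ∈ Icc (0:ℝ) 1, f (γ t) ≠ ⊤})
    (hne : Γ.Nonempty)
    (c₁ c₂ : ℝ)
    (hc₁ : (c₁ : EReal) = ⨅ u ∈ {u : X | ‖u‖ ≤ r}, f u)
    (hc₂ : (c₂ : EReal) = ⨅ γ ∈ Γ, ⨆ t ∈ Icc (0:ℝ) 1, f (γ t))
    (hPS₁ : PScond f c₁) (hPS₂ : PScond f c₂) :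
    c₁ < c₂ ∧ ∃ u₁ u₂ : X,
      (f u₁ ≠ ⊤ ∧ wslope f u₁ = 0 ∧ f u₁ = (c₁ : EReal)) ∧
      (f u₂ ≠ ⊤ ∧ wslope f u₂ = 0 ∧ f u₂ = (c₂ : EReal)) := by
  subst hΓ
  obtain ⟨m, hm0, hm⟩ := EReal.lt_iff_exists_real_btwn.1 hgeom
  have hmS : ∀ u : X, ‖u‖ = r → (m : EReal) < f u := fun u hu => hm.trans_le (iInf₂_le u hu)
  obtain ⟨hm0, hm1⟩ := max_lt_iff.1 hm0
  obtain ⟨a₀, ha₀⟩ : ∃ a : ℝ, f v₀ = a :=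
    ⟨(f v₀).toReal, (EReal.coe_toReal (ne_top_of_lt hm0) (hbot _)).symm⟩
  obtain ⟨a₁, ha₁⟩ : ∃ a : ℝ, f v₁ = a :=
    ⟨(f v₁).toReal, (EReal.coe_toReal (ne_top_of_lt hm1) (hbot _)).symm⟩
  have hc₁m : c₁ < m := by
    rw [← EReal.coe_lt_coe_iff, hc₁]
    exact (iInf₂_le v₀ h0.le).trans_lt hm0
  have hcross : ∀ γ : ℝ → X, ContinuousOn γ (Icc 0 1) → γ 0 = v₀ → γ 1 = v₁ →
      ∃ t ∈ Icc (0 : ℝ) 1, ‖γ t‖ = r := fun γ hγ hγ0 hγ1 =>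
    intermediate_value_Icc zero_le_one hγ.norm ⟨by rw [hγ0]; exact h0.le, by rw [hγ1]; exact h1.le⟩
  have hmc₂ : m ≤ c₂ := by
    rw [← EReal.coe_le_coe_iff, hc₂]
    refine le_iInf₂ fun γ ⟨hγ, hγ0, hγ1, _⟩ => ?_
    obtain ⟨t, ht, htr⟩ := hcross γ hγ hγ0 hγ1
    exact (hmS _ htr).le.trans (le_iSup₂ (f := fun t _ => f (γ t)) t ht)
  rw [ha₀, EReal.coe_lt_coe_iff] at hm0
  rw [ha₁, EReal.coe_lt_coe_iff] at hm1
  refine ⟨hc₁m.trans_le hmc₂, ?_⟩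
  obtain ⟨u₁, hu₁⟩ := exists_critical_of_slopeG_le hlsc h33 hPS₁ fun ε hε =>
    exists_slopeG_le_of_minimum hlsc (D := {u : X | ‖u‖ ≤ r})
      (isClosed_le continuous_norm continuous_const) hc₁m
      (fun u hu hfu => by
        have hne : ‖u‖ ≠ r := fun h => (hmS u h).not_gt hfu
        filter_upwards [(isOpen_lt continuous_norm continuous_const).mem_nhds
          (lt_of_le_of_ne hu hne)] with x hx
        exact le_of_lt hx)
      (fun u hu => hc₁ ▸ iInf₂_le u hu)
      (fun b hb => by
        rw [← EReal.coe_lt_coe_iff, hc₁] at hb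
        simpa [iInf_lt_iff] using hb) hε
  obtain ⟨u₂, hu₂⟩ := exists_critical_of_slopeG_le hlsc h33 hPS₂ fun ε hε =>
    exists_slopeG_le_of_mountainPass hlsc (p₀ := (v₀, a₀)) (p₁ := (v₁, a₁))
      (hm0.trans_le hmc₂) (hm1.trans_le hmc₂)
      (fun γ hγ hγ0 hγ1 => by
        rw [← EReal.coe_le_coe_iff, hc₂]
        have hle : ∀ t, f (γ (projIcc 0 1 zero_le_one t)).1 ≤ (maxHeight γ : EReal) := fun t =>
          (hγ _).trans (EReal.coe_le_coe_iff.2 (le_maxHeight γ _))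
        refine (iInf₂_le (fun t : ℝ => (γ (projIcc 0 1 zero_le_one t)).1)
          ⟨?_, ?_, ?_, fun t _ => ((hle t).trans_lt (EReal.coe_lt_top _)).ne⟩).trans
          (iSup₂_le fun t _ => hle t)
        · exact (continuous_fst.comp (γ.continuous.comp continuous_projIcc)).continuousOn
        · simp [hγ0]
        · simp [hγ1])
      (fun ε hε => by
        have hlt : (⨅ γ ∈ {γ : ℝ → X | ContinuousOn γ (Icc 0 1) ∧ γ 0 = v₀ ∧ γ 1 = v₁ ∧
            ∀ t ∈ Icc (0:ℝ) 1, f (γ t) ≠ ⊤}, ⨆ t ∈ Icc (0:ℝ) 1, f (γ t)) <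
            ((c₂ + ε : ℝ) : EReal) := by
          rw [← hc₂, EReal.coe_lt_coe_iff]
          linarith
        obtain ⟨γ, ⟨hγ, rfl, rfl, -⟩, hγlt⟩ := by simpa only [iInf_lt_iff, exists_prop] using hlt
        exact exists_lift_epiSet hγ ha₀ ha₁ fun t ht =>
          (le_iSup₂ (f := fun t _ => f (γ t)) t ht).trans hγlt.le) hε
  exact ⟨u₁, u₂, hu₁, hu₂⟩
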